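/- A set C of two-colored partitions is a category of two-colored partitions if and only if C contains the white identity partition (one white upper point connected to one white lower point) and C is closed under tensor products, the four basic rotations, verticolor reflection, and erasing turns. -/

import Mathlib

noncomputable section
attribute [local instance] Classical.propDecidable

/-- A two-colored partition: two rows of points colored white (`true`) or black (`false`),
together with a set partition (setoid) of all points into blocks. -/
structure TCP where
  upper : ℕ
  lower : ℕ
  upColor : Fin upper → Bool
  loColor : Fin lower → Bool
  rel : Setoid (Fin upper ⊕ Fin lower)

namespace TCP

/-- The points of a partition. -/
abbrev Point (p : TCP) := Fin p.upper ⊕ Fin p.lower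

/-- Native color of a point. -/
def color (p : TCP) : p.Point → Bool
  | .inl j => p.upColor j
  | .inr i => p.loColor i

/-- Normalized color: inverted on the upper row. -/
def ncolor (p : TCP) : p.Point → Bool
  | .inl j => !(p.upColor j)
  | .inr i => p.loColor i

/-- Sign of a point: `+1` for normalized white, `-1` for normalized black. -/
def sgn (p : TCP) (x : p.Point) : ℤ := if p.ncolor x then 1 else -1

/-- Color sum of a finite set of points. -/
def csum (p : TCP) (S : Finset p.Point) : ℤ := ∑ x ∈ S, p.sgn x

/-- Total color sum Σ(p). -/
def tsum (p : TCP) : ℤ := p.csum Finset.univ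

/-- Total number of points. -/
def size (p : TCP) : ℕ := p.upper + p.lower

/-- Position in the counter-clockwise cyclic order: lower points left to right,
then upper points right to left. -/
def pos (p : TCP) : p.Point → ℕ
  | .inr i => i
  | .inl j => p.lower + (p.upper - 1 - j)

/-- Cyclic position of `y` relative to `x`. -/
def relpos (p : TCP) (x y : p.Point) : ℕ := (p.size + p.pos y - p.pos x) % p.size

/-- Half-open cyclic interval `]x,y]`. -/
def Ioc (p : TCP) (x y : p.Point) : Finset p.Point :=
  Finset.univ.filter (fun z => 0 < p.relpos x z ∧ p.relpos x z ≤ p.relpos x y)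

/-- Open cyclic interval `]x,y[`. -/
def Ioo (p : TCP) (x y : p.Point) : Finset p.Point :=
  Finset.univ.filter (fun z => 0 < p.relpos x z ∧ p.relpos x z < p.relpos x y)

/-- The color distance between two points. -/
def cdist (p : TCP) (x y : p.Point) : ℤ :=
  if x = y then p.tsum
  else if p.ncolor x = p.ncolor y then p.csum (p.Ioc x y)
  else p.csum (p.Ioo x y)

/-- The block of a point. -/
def blockOf (p : TCP) (x : p.Point) : Finset p.Point :=
  Finset.univ.filter (fun y => p.rel.r x y)

/-- A finite set of points is a block of `p`. -/
def IsBlock (p : TCP) (B : Finset p.Point) : Prop := ∃ x, B = p.blockOf x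

/-- `(a,b,c,d)` is ordered in the cyclic order of `p`. -/
def Ordered4 (p : TCP) (a b c d : p.Point) : Prop :=
  0 < p.relpos a b ∧ p.relpos a b < p.relpos a c ∧ p.relpos a c < p.relpos a d

/-- Two sets of points cross each other. -/
def Cross (p : TCP) (B₁ B₂ : Finset p.Point) : Prop :=
  ∃ a ∈ B₁, ∃ b ∈ B₁, ∃ a' ∈ B₂, ∃ b' ∈ B₂, p.Ordered4 a a' b b'

/-! ### The analyzer -/

/-- Set of block sizes. -/
def Fset (S : Set TCP) : Set ℕ :=
  {n | ∃ p ∈ S, ∃ B : Finset p.Point, p.IsBlock B ∧ B.card = n}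

/-- Set of block color sums. -/
def Vset (S : Set TCP) : Set ℤ :=
  {v | ∃ p ∈ S, ∃ B : Finset p.Point, p.IsBlock B ∧ p.csum B = v}

/-- Set of total color sums. -/
def Sset (S : Set TCP) : Set ℤ := {s | ∃ p ∈ S, p.tsum = s}

/-- Set of color distances between cyclically subsequent legs of the same block
having the same normalized color. -/
def Lset (S : Set TCP) : Set ℤ :=
  {d | ∃ p ∈ S, ∃ B : Finset p.Point, p.IsBlock B ∧ ∃ a ∈ B, ∃ b ∈ B, a ≠ b ∧
        p.Ioo a b ∩ B = ∅ ∧ p.ncolor a = p.ncolor b ∧ p.cdist a b = d}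

/-- Set of color distances between cyclically subsequent legs of the same block
having different normalized colors. -/
def Kset (S : Set TCP) : Set ℤ :=
  {d | ∃ p ∈ S, ∃ B : Finset p.Point, p.IsBlock B ∧ ∃ a ∈ B, ∃ b ∈ B, a ≠ b ∧
        p.Ioo a b ∩ B = ∅ ∧ p.ncolor a ≠ p.ncolor b ∧ p.cdist a b = d}

/-- Set of color distances between legs of two crossing blocks. -/
def Xset (S : Set TCP) : Set ℤ :=
  {d | ∃ p ∈ S, ∃ B₁ B₂ : Finset p.Point, p.IsBlock B₁ ∧ p.IsBlock B₂ ∧ B₁ ≠ B₂ ∧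
        p.Cross B₁ B₂ ∧ ∃ a ∈ B₁, ∃ b ∈ B₂, p.cdist a b = d}

/-- The parameter domain. -/
abbrev Param := Set ℕ × Set ℤ × Set ℤ × Set ℤ × Set ℤ × Set ℤ

/-- The analyzer `Z = (F, V, Σ, L, K, X)`. -/
def Z (S : Set TCP) : Param := (Fset S, Vset S, Sset S, Lset S, Kset S, Xset S)

/-! ### Operations on partitions -/

/-- Componentwise relation on a sum type. -/
def sumRel {α β : Type*} (s : α → α → Prop) (t : β → β → Prop) : α ⊕ β → α ⊕ β → Prop
  | .inl a, .inl b => s a b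
  | .inr a, .inr b => t a b
  | _, _ => False

/-- Componentwise setoid on a sum type. -/
def sumSetoid {α β : Type*} (s : Setoid α) (t : Setoid β) : Setoid (α ⊕ β) where
  r := sumRel s.r t.r
  iseqv := by
    refine ⟨?_, ?_, ?_⟩
    · rintro (a | a) <;> exact Setoid.refl _
    · rintro (a | a) (b | b) h <;> first | exact Setoid.symm h | exact h.elim
    · rintro (a | a) (b | b) (c | c) h₁ h₂ <;>
        first | exact Setoid.trans h₁ h₂ | exact h₁.elim | exact h₂.elim

/-- Identification of the points of a tensor product with a sum of points. -/
def ptmap (p q : TCP) :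
    (Fin (p.upper + q.upper) ⊕ Fin (p.lower + q.lower)) → (p.Point ⊕ q.Point)
  | .inl j => (finSumFinEquiv.symm j).elim (fun a => .inl (.inl a)) (fun a => .inr (.inl a))
  | .inr i => (finSumFinEquiv.symm i).elim (fun a => .inl (.inr a)) (fun a => .inr (.inr a))

/-- Tensor product: horizontal concatenation. -/
def tensor (p q : TCP) : TCP where
  upper := p.upper + q.upper
  lower := p.lower + q.lower
  upColor := fun j => (finSumFinEquiv.symm j).elim p.upColor q.upColor
  loColor := fun i => (finSumFinEquiv.symm i).elim p.loColor q.loColor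
  rel := Setoid.comap (ptmap p q) (sumSetoid p.rel q.rel)

/-- Embedding of the points of `p` into the points of `p.tensor q`. -/
def tinl (p q : TCP) : p.Point → (p.tensor q).Point
  | .inl j => Sum.inl (Fin.castAdd q.upper j)
  | .inr i => Sum.inr (Fin.castAdd q.lower i)

/-- Embedding of the points of `q` into the points of `p.tensor q`. -/
def tinr (p q : TCP) : q.Point → (p.tensor q).Point
  | .inl j => Sum.inl (Fin.natAdd p.upper j)
  | .inr i => Sum.inr (Fin.natAdd p.lower i)

/-- Involution: swapping the rows. -/
def invol (p : TCP) : TCP where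
  upper := p.lower
  lower := p.upper
  upColor := p.loColor
  loColor := p.upColor
  rel := Setoid.comap Sum.swap p.rel

/-- `(p, q)` is composable: the upper row of `p` matches the lower row of `q`. -/
structure Composable (p q : TCP) : Prop where
  len : p.upper = q.lower
  col : ∀ j : Fin p.upper, p.upColor j = q.loColor (Fin.cast len j)

/-- Generating relation for the composition of `p` and `q`. -/
def compRel (p q : TCP) (h : p.upper = q.lower) :
    (q.Point ⊕ p.Point) → (q.Point ⊕ p.Point) → Prop := fun x y =>
  (∃ a b, x = .inl a ∧ y = .inl b ∧ q.rel.r a b) ∨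
  (∃ a b, x = .inr a ∧ y = .inr b ∧ p.rel.r a b) ∨
  (∃ j : Fin p.upper, x = .inl (.inr (Fin.cast h j)) ∧ y = .inr (.inl j)) ∨
  (∃ j : Fin p.upper, y = .inl (.inr (Fin.cast h j)) ∧ x = .inr (.inl j))

/-- Composition: vertical concatenation, with blocks joined along the middle row. -/
def comp (p q : TCP) (h : Composable p q) : TCP where
  upper := q.upper
  lower := p.lower
  upColor := q.upColor
  loColor := p.loColor
  rel := Setoid.comap
    (fun x : Fin q.upper ⊕ Fin p.lower => match x with
      | .inl j => Sum.inl (Sum.inl j : q.Point)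
      | .inr i => Sum.inr (Sum.inr i : p.Point))
    (Relation.EqvGen.setoid (compRel p q h.len))

/-- The empty partition. -/
def emptyP : TCP := ⟨0, 0, Fin.elim0, Fin.elim0, ⊤⟩

/-- The identity partition of color `c`: one upper and one lower point of color `c`
joined in one block. -/
def idPart (c : Bool) : TCP := ⟨1, 1, fun _ => c, fun _ => c, ⊤⟩

/-- The one-row pair partition with two lower points of colors `c₁`, `c₂` in one block. -/
def lpair (c₁ c₂ : Bool) : TCP := ⟨0, 2, Fin.elim0, fun i => if i = 0 then c₁ else c₂, ⊤⟩

/-- A category of two-colored partitions. -/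
def IsCategory (C : Set TCP) : Prop :=
  emptyP ∈ C ∧ idPart true ∈ C ∧ idPart false ∈ C ∧
  lpair true false ∈ C ∧ lpair false true ∈ C ∧
  (∀ p q, p ∈ C → q ∈ C → p.tensor q ∈ C) ∧
  (∀ p, p ∈ C → p.invol ∈ C) ∧
  (∀ p q (h : Composable p q), p ∈ C → q ∈ C → comp p q h ∈ C)

/-! ### Rotations, verticolor reflection, erasing -/

/-- Rotate the leftmost upper point down (identity if the upper row is empty). -/
def rotDownL (p : TCP) : TCP :=
  if h : 0 < p.upper then
    { upper := p.upper - 1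
      lower := p.lower + 1
      upColor := fun j => p.upColor ⟨j + 1, by have := j.isLt; omega⟩
      loColor := fun i => Fin.cases (!(p.upColor ⟨0, h⟩)) (fun i' => p.loColor i') i
      rel := Setoid.comap
        (fun x : Fin (p.upper - 1) ⊕ Fin (p.lower + 1) => match x with
          | .inl j => (Sum.inl ⟨j + 1, by have := j.isLt; omega⟩ : p.Point)
          | .inr i => Fin.cases (Sum.inl ⟨0, h⟩ : p.Point) (fun i' => (Sum.inr i' : p.Point)) i)
        p.rel }
  else p

/-- Rotate the rightmost upper point down (identity if the upper row is empty). -/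
def rotDownR (p : TCP) : TCP :=
  if h : 0 < p.upper then
    { upper := p.upper - 1
      lower := p.lower + 1
      upColor := fun j => p.upColor ⟨j, by have := j.isLt; omega⟩
      loColor := fun i =>
        Fin.lastCases (!(p.upColor ⟨p.upper - 1, by omega⟩)) (fun i' => p.loColor i') i
      rel := Setoid.comap
        (fun x : Fin (p.upper - 1) ⊕ Fin (p.lower + 1) => match x with
          | .inl j => (Sum.inl ⟨j, by have := j.isLt; omega⟩ : p.Point)
          | .inr i => Fin.lastCases (Sum.inl ⟨p.upper - 1, by omega⟩ : p.Point)
              (fun i' => (Sum.inr i' : p.Point)) i)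
        p.rel }
  else p

/-- Rotate the leftmost lower point up (identity if the lower row is empty). -/
def rotUpL (p : TCP) : TCP :=
  if h : 0 < p.lower then
    { upper := p.upper + 1
      lower := p.lower - 1
      upColor := fun j => Fin.cases (!(p.loColor ⟨0, h⟩)) (fun j' => p.upColor j') j
      loColor := fun i => p.loColor ⟨i + 1, by have := i.isLt; omega⟩
      rel := Setoid.comap
        (fun x : Fin (p.upper + 1) ⊕ Fin (p.lower - 1) => match x with
          | .inl j => Fin.cases (Sum.inr ⟨0, h⟩ : p.Point) (fun j' => (Sum.inl j' : p.Point)) j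
          | .inr i => (Sum.inr ⟨i + 1, by have := i.isLt; omega⟩ : p.Point))
        p.rel }
  else p

/-- Rotate the rightmost lower point up (identity if the lower row is empty). -/
def rotUpR (p : TCP) : TCP :=
  if h : 0 < p.lower then
    { upper := p.upper + 1
      lower := p.lower - 1
      upColor := fun j =>
        Fin.lastCases (!(p.loColor ⟨p.lower - 1, by omega⟩)) (fun j' => p.upColor j') j
      loColor := fun i => p.loColor ⟨i, by have := i.isLt; omega⟩
      rel := Setoid.comap
        (fun x : Fin (p.upper + 1) ⊕ Fin (p.lower - 1) => match x with
          | .inl j => Fin.lastCases (Sum.inr ⟨p.lower - 1, by omega⟩ : p.Point)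
              (fun j' => (Sum.inl j' : p.Point)) j
          | .inr i => (Sum.inr ⟨i, by have := i.isLt; omega⟩ : p.Point))
        p.rel }
  else p

/-- Verticolor reflection: reverse both rows and invert all colors. -/
def vreflect (p : TCP) : TCP where
  upper := p.upper
  lower := p.lower
  upColor := fun j => !(p.upColor j.rev)
  loColor := fun i => !(p.loColor i.rev)
  rel := Setoid.comap (Sum.map Fin.rev Fin.rev) p.rel

/-- `{a, b}` is a turn: two cyclically consecutive points of inverse normalized colors. -/
def IsTurn (p : TCP) (a b : p.Point) : Prop :=
  p.relpos a b = 1 ∧ p.ncolor a ≠ p.ncolor b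

/-- `e` identifies the points of `q` with the points of `p` outside `{a, b}`, preserving
rows, colors and order, and `q` carries the block structure obtained from `p` by erasing
`{a, b}` and merging all blocks meeting `{a, b}`. -/
def IsErasingMap (p : TCP) (a b : p.Point) (q : TCP) (e : q.Point → p.Point) : Prop :=
  Function.Injective e ∧
  Set.range e = {x | x ≠ a ∧ x ≠ b} ∧
  (∀ j : Fin q.upper, ∃ j', e (.inl j) = Sum.inl j') ∧
  (∀ i : Fin q.lower, ∃ i', e (.inr i) = Sum.inr i') ∧
  (∀ j₁ j₂ : Fin q.upper, ∀ j₁' j₂' : Fin p.upper,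
    e (.inl j₁) = Sum.inl j₁' → e (.inl j₂) = Sum.inl j₂' → (j₁ < j₂ ↔ j₁' < j₂')) ∧
  (∀ i₁ i₂ : Fin q.lower, ∀ i₁' i₂' : Fin p.lower,
    e (.inr i₁) = Sum.inr i₁' → e (.inr i₂) = Sum.inr i₂' → (i₁ < i₂ ↔ i₁' < i₂')) ∧
  (∀ x, q.color x = p.color (e x)) ∧
  (∀ x y, q.rel.r x y ↔
    (p.rel.r (e x) (e y) ∨
      ((p.rel.r (e x) a ∨ p.rel.r (e x) b) ∧ (p.rel.r (e y) a ∨ p.rel.r (e y) b))))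

/-- `q` is obtained from `p` by erasing the turn `{a, b}`. -/
def IsErasing (p : TCP) (a b : p.Point) (q : TCP) : Prop :=
  p.IsTurn a b ∧ ∃ e : q.Point → p.Point, IsErasingMap p a b q e

end TCP

namespace TCP

/-! ### Partitions presented by lists of colored labels -/

/-- The partition whose rows are given by lists of colored labels, two points being in one block
if and only if their labels are related. -/
def ofList {α : Type} (S : Setoid α) (U L : List (Bool × α)) : TCP where
  upper := U.length
  lower := L.length
  upColor := fun j => (U.get j).1
  loColor := fun i => (L.get i).1
  rel := S.comap (Sum.elim (fun j => (U.get j).2) (fun i => (L.get i).2))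

theorem eq_ofList {α : Type} (p : TCP) (S : Setoid α) (U L : List (Bool × α))
    (hu : p.upper = U.length) (hl : p.lower = L.length) (g : p.Point → α)
    (hcu : ∀ j (h : j < p.upper), (p.upColor ⟨j, h⟩, g (.inl ⟨j, h⟩)) = U[j])
    (hcl : ∀ j (h : j < p.lower), (p.loColor ⟨j, h⟩, g (.inr ⟨j, h⟩)) = L[j])
    (hr : ∀ x y, p.rel x y ↔ S (g x) (g y)) : p = ofList S U L := by
  obtain ⟨u, l, cu, cl, r⟩ := p
  dsimp only at hu hl g hcu hcl hr
  subst hu hl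
  have h1 : cu = fun j => (U.get j).1 := by
    funext j
    have := hcu j j.isLt
    simpa using congrArg Prod.fst this
  have h2 : cl = fun j => (L.get j).1 := by
    funext j
    have := hcl j j.isLt
    simpa using congrArg Prod.fst this
  have h3 : g = Sum.elim (fun j => (U.get j).2) (fun i => (L.get i).2) := by
    funext x
    rcases x with j | j
    · have := hcu j j.isLt
      simpa using congrArg Prod.snd this
    · have := hcl j j.isLt
      simpa using congrArg Prod.snd this
  subst h1 h2
  unfold ofList
  congr 1
  ext x y
  rw [hr, h3]
  rfl

/-- upper row with its points as labels -/
def upL (p : TCP) : List (Bool × p.Point) := List.ofFn fun j => (p.upColor j, Sum.inl j)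
/-- lower row with its points as labels -/
def loL (p : TCP) : List (Bool × p.Point) := List.ofFn fun j => (p.loColor j, Sum.inr j)

theorem eq_toList (p : TCP) : p = ofList p.rel p.upL p.loL := by
  apply eq_ofList p _ _ _ (by simp [upL]) (by simp [loL]) id
  · intro j h; simp [upL]
  · intro j h; simp [loL]
  · intro x y; rfl

/-- change of labels -/
abbrev rl {α β : Type} (f : α → β) (L : List (Bool × α)) : List (Bool × β) :=
  L.map (Prod.map id f)

theorem newLabels {α β : Type} (f : α → β) (S : Setoid α) (T : Setoid β) (U L : List (Bool × α))
    (h : ∀ x ∈ U ++ L, ∀ y ∈ U ++ L, S x.2 y.2 ↔ T (f x.2) (f y.2)) :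
    ofList S U L = ofList T (rl f U) (rl f L) := by
  apply eq_ofList _ _ _ _ (by simp [ofList]) (by simp [ofList])
    (fun x => f (Sum.elim (fun j => (U.get j).2) (fun i => (L.get i).2) x))
  · intro j h; simp [ofList]; rfl
  · intro j h; simp [ofList]; rfl
  · intro x y
    have key : ∀ z : (ofList S U L).Point, ∃ x ∈ U ++ L,
        (Sum.elim (fun j => (U.get j).2) (fun i => (L.get i).2) z) = x.2 := by
      rintro (j | j)
      · exact ⟨U.get j, List.mem_append_left _ (List.get_mem _ _), rfl⟩
      · exact ⟨L.get j, List.mem_append_right _ (List.get_mem _ _), rfl⟩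
    obtain ⟨a, ha, ha'⟩ := key x
    obtain ⟨b, hb, hb'⟩ := key y
    have := h a ha b hb
    rw [← ha', ← hb'] at this
    exact this

theorem tensor_ofList {α β : Type} (S : Setoid α) (T : Setoid β) (U L : List (Bool × α))
    (U' L' : List (Bool × β)) :
    (ofList S U L).tensor (ofList T U' L') =
      ofList (sumSetoid S T) (rl .inl U ++ rl .inr U') (rl .inl L ++ rl .inr L') := by
  apply eq_ofList _ _ _ _ (by simp [ofList, tensor]) (by simp [ofList, tensor])
    (fun x => Sum.map (Sum.elim (fun j => (U.get j).2) (fun i => (L.get i).2))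
      (Sum.elim (fun j => (U'.get j).2) (fun i => (L'.get i).2)) (ptmap _ _ x))
  · intro j h
    have hj : j < U.length + U'.length := h
    obtain ⟨z, hz⟩ := finSumFinEquiv.surjective (⟨j, hj⟩ : Fin (U.length + U'.length))
    rcases z with z | z
    · have hz' : j = z := by simpa [Fin.ext_iff] using hz.symm
      have e1 : (finSumFinEquiv.symm (⟨j, hj⟩ : Fin (U.length + U'.length))) = .inl z := by
        rw [← hz]; simp
      simp only [tensor, ofList, ptmap]
      rw [e1]
      erw [e1]
      subst hz'
      simp
      rfl
    · have hz' : j = U.length + z := by simpa [Fin.ext_iff] using hz.symm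
      have e1 : (finSumFinEquiv.symm (⟨j, hj⟩ : Fin (U.length + U'.length))) = .inr z := by
        rw [← hz]; simp
      simp only [tensor, ofList, ptmap]
      rw [e1]
      erw [e1]
      subst hz'
      simp
      rfl
  · intro j h
    have hj : j < L.length + L'.length := h
    obtain ⟨z, hz⟩ := finSumFinEquiv.surjective (⟨j, hj⟩ : Fin (L.length + L'.length))
    rcases z with z | z
    · have hz' : j = z := by simpa [Fin.ext_iff] using hz.symm
      have e1 : (finSumFinEquiv.symm (⟨j, hj⟩ : Fin (L.length + L'.length))) = .inl z := by
        rw [← hz]; simp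
      simp only [tensor, ofList, ptmap]
      rw [e1]
      erw [e1]
      subst hz'
      simp
      rfl
    · have hz' : j = L.length + z := by simpa [Fin.ext_iff] using hz.symm
      have e1 : (finSumFinEquiv.symm (⟨j, hj⟩ : Fin (L.length + L'.length))) = .inr z := by
        rw [← hz]; simp
      simp only [tensor, ofList, ptmap]
      rw [e1]
      erw [e1]
      subst hz'
      simp
      rfl
  · intro x y
    have key : ∀ a b : (ofList S U L).Point ⊕ (ofList T U' L').Point,
        sumSetoid (ofList S U L).rel (ofList T U' L').rel a b ↔
        sumSetoid S T (Sum.map (Sum.elim (fun j => (U.get j).2) (fun i => (L.get i).2))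
      (Sum.elim (fun j => (U'.get j).2) (fun i => (L'.get i).2)) a)
      (Sum.map (Sum.elim (fun j => (U.get j).2) (fun i => (L.get i).2))
      (Sum.elim (fun j => (U'.get j).2) (fun i => (L'.get i).2)) b) := by
      rintro (a | a) (b | b) <;> exact Iff.rfl
    exact key _ _

/-- invert the color -/
def fl {α : Type} (a : Bool × α) : Bool × α := (!a.1, a.2)

@[simp] theorem fl_fl {α : Type} (a : Bool × α) : fl (fl a) = a := by simp [fl]

/-- reverse and invert all colors -/
def rf {α : Type} (L : List (Bool × α)) : List (Bool × α) := (L.map fl).reverse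

@[simp] theorem rf_nil {α : Type} : rf ([] : List (Bool × α)) = [] := rfl
@[simp] theorem rf_rf {α : Type} (L : List (Bool × α)) : rf (rf L) = L := by
  simp [rf, Function.comp_def]
@[simp] theorem rf_append {α : Type} (L M : List (Bool × α)) : rf (L ++ M) = rf M ++ rf L := by
  simp [rf]
@[simp] theorem rf_cons {α : Type} (a) (M : List (Bool × α)) : rf (a :: M) = rf M ++ [fl a] := by
  simp [rf]

theorem invol_ofList {α : Type} (S : Setoid α) (U L : List (Bool × α)) :
    (ofList S U L).invol = ofList S L U := by
  apply eq_ofList _ _ _ _ (by simp [ofList, invol]) (by simp [ofList, invol])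
    (fun x => Sum.elim (fun j => (U.get j).2) (fun i => (L.get i).2) x.swap)
  · intro j h; simp [ofList, invol]
  · intro j h; simp [ofList, invol]
  · intro x y; exact Iff.rfl

theorem vreflect_ofList {α : Type} (S : Setoid α) (U L : List (Bool × α)) :
    (ofList S U L).vreflect = ofList S (rf U) (rf L) := by
  apply eq_ofList _ _ _ _ (by simp [ofList, vreflect, rf]) (by simp [ofList, vreflect, rf])
    (fun x => Sum.elim (fun j => (U.get j).2) (fun i => (L.get i).2) (x.map Fin.rev Fin.rev))
  · intro j h; simp [ofList, vreflect, rf, fl, Fin.rev, Nat.sub_sub, Nat.add_comm]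
  · intro j h; simp [ofList, vreflect, rf, fl, Fin.rev, Nat.sub_sub, Nat.add_comm]
  · intro x y; exact Iff.rfl

theorem rotDownL_ofList {α : Type} (S : Setoid α) (a) (U L : List (Bool × α)) :
    (ofList S (a :: U) L).rotDownL = ofList S U (fl a :: L) := by
  have h : 0 < (ofList S (a :: U) L).upper := by simp [ofList]
  rw [rotDownL, dif_pos h]
  refine eq_ofList _ _ _ _ (by simp [ofList]) (by simp [ofList])
    (fun x => Sum.elim (fun j => ((a :: U).get j).2) (fun i => (L.get i).2)
      (match x with
          | .inl j => (Sum.inl ⟨j + 1, by have := j.isLt; dsimp only at this; omega⟩ : (ofList S (a :: U) L).Point)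
          | .inr i => Fin.cases (Sum.inl ⟨0, h⟩ : (ofList S (a :: U) L).Point)
            (fun i' => (Sum.inr i' : (ofList S (a :: U) L).Point)) i)) ?_ ?_ ?_
  rotate_left
  rotate_left
  · rintro (x | x) (y | y) <;> exact Iff.rfl
  · intro j h; simp [ofList]
  · intro j h
    rcases j with _ | j
    · simp [ofList, fl]
    · rfl

theorem rotUpL_ofList {α : Type} (S : Setoid α) (a) (U L : List (Bool × α)) :
    (ofList S U (a :: L)).rotUpL = ofList S (fl a :: U) L := by
  have h : 0 < (ofList S U (a :: L)).lower := by simp [ofList]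
  rw [rotUpL, dif_pos h]
  refine eq_ofList _ _ _ _ (by simp [ofList]) (by simp [ofList])
    (fun x => Sum.elim (fun j => (U.get j).2) (fun i => ((a :: L).get i).2)
      (match x with
          | .inl j => Fin.cases (Sum.inr ⟨0, h⟩ : (ofList S U (a :: L)).Point)
            (fun j' => (Sum.inl j' : (ofList S U (a :: L)).Point)) j
          | .inr i => (Sum.inr ⟨i + 1, by have := i.isLt; dsimp only at this; omega⟩ : (ofList S U (a :: L)).Point))) ?_ ?_ ?_
  rotate_left
  rotate_left
  · rintro (x | x) (y | y) <;> exact Iff.rfl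
  · intro j h
    rcases j with _ | j
    · simp [ofList, fl]
    · rfl
  · intro j h; simp [ofList]

theorem lastCases_mk {n : ℕ} {M : Type} (x : M) (f : Fin n → M) (j : ℕ) (h : j < n + 1) :
    Fin.lastCases (motive := fun _ => M) x f ⟨j, h⟩ = if h' : j < n then f ⟨j, h'⟩ else x := by
  split_ifs with h'
  · exact Fin.lastCases_castSucc (motive := fun _ => M) (i := ⟨j, h'⟩) ..
  · have : j = n := by omega
    subst this
    exact Fin.lastCases_last (motive := fun _ => M) ..

theorem rotDownR_ofList {α : Type} (S : Setoid α) (a) (U L : List (Bool × α)) :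
    (ofList S (U ++ [a]) L).rotDownR = ofList S U (L ++ [fl a]) := by
  have h : 0 < (ofList S (U ++ [a]) L).upper := by simp [ofList]
  rw [rotDownR, dif_pos h]
  refine eq_ofList _ _ _ _ (by simp [ofList]) (by simp [ofList])
    (fun x => Sum.elim (fun j => ((U ++ [a]).get j).2) (fun i => (L.get i).2)
      (match x with
          | .inl j => (Sum.inl ⟨j, by have := j.isLt; dsimp only at this; omega⟩ : (ofList S (U ++ [a]) L).Point)
          | .inr i => Fin.lastCases (Sum.inl ⟨(ofList S (U ++ [a]) L).upper - 1, by omega⟩ :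
              (ofList S (U ++ [a]) L).Point)
              (fun i' => (Sum.inr i' : (ofList S (U ++ [a]) L).Point)) i)) ?_ ?_ ?_
  rotate_left
  rotate_left
  · rintro (x | x) (y | y) <;> exact Iff.rfl
  · intro j h
    have hj : j < U.length := by simpa [ofList] using h
    simp [ofList, hj]
  · intro j h
    have hj : j < L.length + 1 := h
    dsimp only
    erw [lastCases_mk, lastCases_mk]
    by_cases h1 : j < L.length
    · have h2 : j < (ofList S (U ++ [a]) L).lower := h1
      simp only [dif_pos h2, List.getElem_append_left h1]
      rfl
    · have h2 : ¬ j < (ofList S (U ++ [a]) L).lower := h1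
      have : j = L.length := by omega
      subst this
      simp only [dif_neg h2]
      simp [ofList, fl]

theorem rotUpR_ofList {α : Type} (S : Setoid α) (a) (U L : List (Bool × α)) :
    (ofList S U (L ++ [a])).rotUpR = ofList S (U ++ [fl a]) L := by
  have h : 0 < (ofList S U (L ++ [a])).lower := by simp [ofList]
  rw [rotUpR, dif_pos h]
  refine eq_ofList _ _ _ _ (by simp [ofList]) (by simp [ofList])
    (fun x => Sum.elim (fun j => (U.get j).2) (fun i => ((L ++ [a]).get i).2)
      (match x with
          | .inl j => Fin.lastCases (Sum.inr ⟨(ofList S U (L ++ [a])).lower - 1, by omega⟩ :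
              (ofList S U (L ++ [a])).Point)
              (fun j' => (Sum.inl j' : (ofList S U (L ++ [a])).Point)) j
          | .inr i => (Sum.inr ⟨i, by have := i.isLt; dsimp only at this; omega⟩ : (ofList S U (L ++ [a])).Point))) ?_ ?_ ?_
  rotate_left
  rotate_left
  · rintro (x | x) (y | y) <;> exact Iff.rfl
  · intro j h
    have hj : j < U.length + 1 := h
    dsimp only
    erw [lastCases_mk, lastCases_mk]
    by_cases h1 : j < U.length
    · have h2 : j < (ofList S U (L ++ [a])).upper := h1
      simp only [dif_pos h2, List.getElem_append_left h1]
      rfl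
    · have h2 : ¬ j < (ofList S U (L ++ [a])).upper := h1
      have : j = U.length := by omega
      subst this
      simp only [dif_neg h2]
      simp [ofList, fl]
  · intro j h
    have hj : j < L.length := by simpa [ofList] using h
    simp [ofList, hj]

/-! ### Gluing -/

/-- glue all pairs in a list -/
def glue {α : Type} (S : Setoid α) (ps : List (α × α)) : Setoid α :=
  S ⊔ Relation.EqvGen.setoid (fun a b => (a, b) ∈ ps)

theorem le_glue {α : Type} (S : Setoid α) (ps : List (α × α)) : S ≤ glue S ps := le_sup_left

theorem glue_mem {α : Type} (S : Setoid α) (ps : List (α × α)) {x y} (h : (x, y) ∈ ps) :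
    glue S ps x y :=
  (le_sup_right : _ ≤ glue S ps) (Relation.EqvGen.rel x y h)

theorem glue_le {α : Type} {S T : Setoid α} {ps : List (α × α)} (h1 : S ≤ T)
    (h2 : ∀ x y, (x, y) ∈ ps → T x y) : glue S ps ≤ T := by
  refine sup_le h1 ?_
  intro x y h
  exact Setoid.eqvGen_le h2 h

theorem glue_nil {α : Type} (S : Setoid α) : glue S [] = S :=
  le_antisymm (glue_le le_rfl (by simp)) (le_glue _ _)

theorem glue_cons {α : Type} (S : Setoid α) (x y) (ps : List (α × α)) :
    glue S ((x, y) :: ps) = glue (glue S [(x, y)]) ps := by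
  apply le_antisymm
  · refine glue_le ((le_glue _ _).trans (le_glue _ _)) ?_
    intro a b h
    rcases List.mem_cons.1 h with h | h
    · exact le_glue _ _ (glue_mem _ _ (by simp [h]))
    · exact glue_mem _ _ h
  · refine glue_le (glue_le (le_glue _ _) ?_) ?_
    · intro a b h; exact glue_mem _ _ (by simp_all)
    · intro a b h; exact glue_mem _ _ (by simp_all)

theorem glue_one {α : Type} (S : Setoid α) (x y a b : α) :
    glue S [(x, y)] a b ↔ S a b ∨ ((S a x ∨ S a y) ∧ (S b x ∨ S b y)) := by
  constructor
  · let T : Setoid α := ⟨fun a b => S a b ∨ ((S a x ∨ S a y) ∧ (S b x ∨ S b y)), by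
      refine ⟨fun a => .inl (S.refl a), ?_, ?_⟩
      · rintro a b (h | h)
        · exact .inl (S.symm h)
        · exact .inr h.symm
      · rintro a b c (h | h) (h' | h')
        · exact .inl (S.trans h h')
        · exact .inr ⟨h'.1.imp (S.trans h) (S.trans h), h'.2⟩
        · exact .inr ⟨h.1, h.2.imp (S.trans (S.symm h')) (S.trans (S.symm h'))⟩
        · exact .inr ⟨h.1, h'.2⟩⟩
    have : glue S [(x, y)] ≤ T := by
      refine glue_le (fun a b h => Or.inl h) ?_
      intro a b h
      simp only [List.mem_singleton, Prod.mk.injEq] at h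
      obtain ⟨rfl, rfl⟩ := h
      exact .inr ⟨.inl (S.refl _), .inr (S.refl _)⟩
    exact fun h => this h
  · set G := glue S [(x, y)]
    have hxy : G x y := glue_mem _ _ (by simp)
    have hS : ∀ {u v}, S u v → G u v := fun h => le_glue S [(x, y)] h
    rintro (h | ⟨h, h'⟩)
    · exact hS h
    · have h1 : G a x := h.elim hS fun h => G.trans (hS h) (G.symm hxy)
      have h2 : G b x := h'.elim hS fun h => G.trans (hS h) (G.symm hxy)
      exact G.trans h1 (G.symm h2)

theorem comp_ofList {α β : Type} (S : Setoid α) (T : Setoid β) (M L : List (Bool × α))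
    (W M' : List (Bool × β)) (h : Composable (ofList S M L) (ofList T W M')) :
    comp (ofList S M L) (ofList T W M') h =
      ofList (glue (sumSetoid S T) (List.zip (M.map (fun a => Sum.inl a.2))
        (M'.map (fun a => Sum.inr a.2)))) (rl .inr W) (rl .inl L) := by
  set ps := List.zip (M.map (fun a => (Sum.inl a.2 : α ⊕ β))) (M'.map (fun a => Sum.inr a.2))
    with hps
  set G := glue (sumSetoid S T) ps with hG
  let lq : (ofList T W M').Point → β := Sum.elim (fun j => (W.get j).2) (fun i => (M'.get i).2)
  let lp : (ofList S M L).Point → α := Sum.elim (fun j => (M.get j).2) (fun i => (L.get i).2)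
  let lab : (ofList T W M').Point ⊕ (ofList S M L).Point → α ⊕ β :=
    Sum.elim (fun x => .inr (lq x)) (fun x => .inl (lp x))
  have hlen : M.length = M'.length := h.len
  set E := Relation.EqvGen.setoid (compRel _ _ h.len) with hE
  have hps' : ∀ s t, (s, t) ∈ ps ↔ ∃ j : Fin M.length, s = .inl (M.get j).2 ∧
      t = .inr (M'.get (Fin.cast hlen j)).2 := by
    intro s t
    rw [hps, List.mem_iff_getElem]
    constructor
    · rintro ⟨i, hi, h⟩
      have hi' : i < M.length := by simp at hi; omega
      refine ⟨⟨i, hi'⟩, ?_⟩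
      simp at h
      simp [h.1, h.2]
    · rintro ⟨j, rfl, rfl⟩
      refine ⟨j, by simp; omega, by simp⟩
  have key : ∀ x y, E x y ↔ G (lab x) (lab y) := by
    have fwd : E ≤ G.comap lab := by
      apply Setoid.eqvGen_le
      rintro x y (⟨a, b, rfl, rfl, hab⟩ | ⟨a, b, rfl, rfl, hab⟩ | ⟨j, rfl, rfl⟩ | ⟨j, rfl, rfl⟩)
      · exact le_glue _ _ (show sumSetoid S T (.inr _) (.inr _) from hab)
      · exact le_glue _ _ (show sumSetoid S T (.inl _) (.inl _) from hab)
      · exact G.symm (glue_mem _ _ ((hps' _ _).2 ⟨j, rfl, rfl⟩))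
      · exact (glue_mem _ _ ((hps' _ _).2 ⟨j, rfl, rfl⟩))
    have base : ∀ x y, sumSetoid S T (lab x) (lab y) → E x y := by
      rintro (x | x) (y | y) hxy
      · exact Relation.EqvGen.rel _ _ (.inl ⟨x, y, rfl, rfl, hxy⟩)
      · exact hxy.elim
      · exact hxy.elim
      · exact Relation.EqvGen.rel _ _ (.inr (.inl ⟨x, y, rfl, rfl, hxy⟩))
    let Φ : α ⊕ β → Set ((ofList T W M').Point ⊕ (ofList S M L).Point) :=
      fun s => {x | ∃ y, E x y ∧ sumSetoid S T (lab y) s}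
    have hΦ : ∀ x, Φ (lab x) = {y | E y x} := by
      intro x
      ext y
      constructor
      · rintro ⟨z, h1, h2⟩
        exact E.trans h1 (base _ _ h2)
      · intro h1
        exact ⟨x, h1, (sumSetoid S T).refl _⟩
    have hle : G ≤ Setoid.ker Φ := by
      apply glue_le
      · intro s t hst
        change Φ s = Φ t
        ext x
        constructor
        · rintro ⟨z, h1, h2⟩
          exact ⟨z, h1, (sumSetoid S T).trans h2 hst⟩
        · rintro ⟨z, h1, h2⟩
          exact ⟨z, h1, (sumSetoid S T).trans h2 ((sumSetoid S T).symm hst)⟩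
      · intro s t hst
        obtain ⟨j, rfl, rfl⟩ := (hps' _ _).1 hst
        change Φ (lab (.inr (.inl j))) = Φ (lab (.inl (.inr (Fin.cast hlen j))))
        rw [hΦ, hΦ]
        have : E (.inr (.inl j)) (.inl (.inr (Fin.cast hlen j))) :=
          Relation.EqvGen.rel _ _ (.inr (.inr (.inr ⟨j, rfl, rfl⟩)))
        ext y
        exact ⟨fun h => E.trans h this, fun h => E.trans h (E.symm this)⟩
    intro x y
    refine ⟨fun h => fwd h, fun h => ?_⟩
    have h1 : Φ (lab x) = Φ (lab y) := hle h
    have h2 : x ∈ Φ (lab x) := by rw [hΦ]; exact E.refl x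
    rw [h1, hΦ] at h2
    exact h2
  refine eq_ofList _ _ _ _ (by simp [ofList, comp]) (by simp [ofList, comp])
    (fun x => lab (match x with
      | .inl j => Sum.inl (Sum.inl j)
      | .inr i => Sum.inr (Sum.inr i))) ?_ ?_ ?_
  · intro j h; simp [ofList, comp, lab, lq]; rfl
  · intro j h; simp [ofList, comp, lab, lp]; rfl
  · rintro (x | x) (y | y) <;> exact key _ _


theorem idPart_eq {α : Type} (S : Setoid α) (c : Bool) (x : α) :
    idPart c = ofList S [(c, x)] [(c, x)] := by
  apply eq_ofList _ _ _ _ rfl rfl (fun _ => x)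
  · intro j h; simp [idPart]
  · intro j h; simp [idPart]
  · intro _ _; exact ⟨fun _ => S.refl x, fun _ => trivial⟩

theorem emptyP_eq {α : Type} (S : Setoid α) : emptyP = ofList S [] [] := by
  apply eq_ofList _ _ _ _ rfl rfl (fun z => z.elim (fun i => i.elim0) (fun i => i.elim0))
  · intro j h; exact absurd h (by simp [emptyP])
  · intro j h; exact absurd h (by simp [emptyP])
  · rintro (x | x) _ <;> exact x.elim0

theorem lpair_eq {α : Type} (S : Setoid α) (c d : Bool) (x y : α) (h : S x y) :
    lpair c d = ofList S [] [(c, x), (d, y)] := by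
  apply eq_ofList _ _ _ _ rfl rfl
    (fun z => z.elim (fun i => i.elim0) (fun i => if i.val = 0 then x else y))
  · intro j h; exact absurd h (by simp [lpair])
  · intro j h
    have : j < 2 := h
    interval_cases j <;> simp [lpair]
  · rintro (i | i) (j | j)
    · exact i.elim0
    · exact i.elim0
    · exact j.elim0
    · refine ⟨fun _ => ?_, fun _ => trivial⟩
      simp only [Sum.elim_inr]
      split_ifs
      · exact S.refl _
      · exact h
      · exact S.symm h
      · exact S.refl _

/-- closure under rotations, in terms of lists -/
structure Rots (C : Set TCP) : Prop where
  dl : ∀ {α : Type} (S : Setoid α) a U L, ofList S (a :: U) L ∈ C → ofList S U (fl a :: L) ∈ C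
  dr : ∀ {α : Type} (S : Setoid α) a U L, ofList S (U ++ [a]) L ∈ C →
    ofList S U (L ++ [fl a]) ∈ C
  ul : ∀ {α : Type} (S : Setoid α) a U L, ofList S U (a :: L) ∈ C → ofList S (fl a :: U) L ∈ C
  ur : ∀ {α : Type} (S : Setoid α) a U L, ofList S U (L ++ [a]) ∈ C →
    ofList S (U ++ [fl a]) L ∈ C

theorem Rots.flat {C : Set TCP} (hC : Rots C) {α : Type} (S : Setoid α) (U L : List (Bool × α)) :
    ofList S U L ∈ C ↔ ofList S [] (L ++ rf U) ∈ C := by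
  induction U using List.reverseRecOn generalizing L with
  | nil => simp
  | append_singleton U a ih =>
    have h1 : ofList S (U ++ [a]) L ∈ C ↔ ofList S U (L ++ [fl a]) ∈ C := by
      refine ⟨hC.dr S a U L, fun h => ?_⟩
      simpa using hC.ur S _ _ _ h
    rw [h1, ih]
    simp

theorem Rots.cyc {C : Set TCP} (hC : Rots C) {α : Type} (S : Setoid α) (A B : List (Bool × α))
    (h : ofList S [] (A ++ B) ∈ C) : ofList S [] (B ++ A) ∈ C := by
  induction A generalizing B with
  | nil => simpa using h
  | cons a A ih =>
    have h1 := hC.ul S a [] (A ++ B) h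
    have h2 := hC.dr S (fl a) [] (A ++ B) h1
    have h3 := ih (B ++ [a]) (by simpa using h2)
    simpa using h3

theorem Rots.refl_invol {C : Set TCP} (hC : Rots C) {α : Type} (S : Setoid α)
    (U L : List (Bool × α)) : ofList S (rf U) (rf L) ∈ C ↔ ofList S L U ∈ C := by
  rw [hC.flat, hC.flat S L U, rf_rf]
  exact ⟨hC.cyc _ _ _, hC.cyc _ _ _⟩

theorem Rots.rot {C : Set TCP} (hC : Rots C) (p : TCP) (hp : p ∈ C) :
    p.rotDownL ∈ C ∧ p.rotDownR ∈ C ∧ p.rotUpL ∈ C ∧ p.rotUpR ∈ C := by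
  rw [eq_toList p] at hp ⊢
  generalize p.upL = U at *
  generalize p.loL = L at *
  refine ⟨?_, ?_, ?_, ?_⟩
  · rcases U with _ | ⟨a, U⟩
    · simpa [rotDownL, ofList] using hp
    · rw [rotDownL_ofList]; exact hC.dl _ _ _ _ hp
  · rcases List.eq_nil_or_concat U with rfl | ⟨U, a, rfl⟩
    · simpa [rotDownR, ofList] using hp
    · rw [List.concat_eq_append] at *
      rw [rotDownR_ofList]; exact hC.dr _ _ _ _ hp
  · rcases L with _ | ⟨a, L⟩
    · simpa [rotUpL, ofList] using hp
    · rw [rotUpL_ofList]; exact hC.ul _ _ _ _ hp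
  · rcases List.eq_nil_or_concat L with rfl | ⟨L, a, rfl⟩
    · simpa [rotUpR, ofList] using hp
    · rw [List.concat_eq_append] at *
      rw [rotUpR_ofList]; exact hC.ur _ _ _ _ hp

/-! ### From categories to the alternative description -/

theorem tensor_disj {C : Set TCP} (hT : ∀ p q, p ∈ C → q ∈ C → p.tensor q ∈ C)
    {α : Type} (S T R : Setoid α) (U L U' L' : List (Bool × α))
    (h1 : ofList S U L ∈ C) (h2 : ofList T U' L' ∈ C)
    (hS : ∀ x ∈ U ++ L, ∀ y ∈ U ++ L, S x.2 y.2 ↔ R x.2 y.2)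
    (hT' : ∀ x ∈ U' ++ L', ∀ y ∈ U' ++ L', T x.2 y.2 ↔ R x.2 y.2)
    (hST : ∀ x ∈ U ++ L, ∀ y ∈ U' ++ L', ¬ R x.2 y.2) :
    ofList R (U ++ U') (L ++ L') ∈ C := by
  have h := hT _ _ h1 h2
  rw [tensor_ofList, newLabels (Sum.elim id id) _ R] at h
  · simpa [rl, Function.comp_def, Prod.map] using h
  · have key : ∀ x ∈ (rl Sum.inl U ++ rl Sum.inr U') ++ (rl Sum.inl L ++ rl Sum.inr L'),
        (∃ y ∈ U ++ L, x.2 = Sum.inl y.2) ∨ (∃ y ∈ U' ++ L', x.2 = (Sum.inr y.2 : α ⊕ α)) := by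
      intro x hx
      simp only [rl, List.mem_append, List.mem_map] at hx
      rcases hx with (⟨y, hy, rfl⟩ | ⟨y, hy, rfl⟩) | (⟨y, hy, rfl⟩ | ⟨y, hy, rfl⟩)
      · exact .inl ⟨y, by simp [hy], rfl⟩
      · exact .inr ⟨y, by simp [hy], rfl⟩
      · exact .inl ⟨y, by simp [hy], rfl⟩
      · exact .inr ⟨y, by simp [hy], rfl⟩
    intro x hx y hy
    rcases key x hx with ⟨x', hx', ex⟩ | ⟨x', hx', ex⟩ <;>
    rcases key y hy with ⟨y', hy', ey⟩ | ⟨y', hy', ey⟩ <;> rw [ex, ey]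
    · exact hS _ hx' _ hy'
    · exact ⟨fun h => h.elim, fun h => (hST _ hx' _ hy' h).elim⟩
    · exact ⟨fun h => h.elim, fun h => (hST _ hy' _ hx' (R.symm h)).elim⟩
    · exact hT' _ hx' _ hy'

theorem idL_mem {C : Set TCP} (hC : IsCategory C) {α : Type} (L : List (Bool × α))
    (hL : (L.map Prod.snd).Nodup) : ofList ⊥ L L ∈ C := by
  obtain ⟨he, ht, hf, -, -, hT, -, -⟩ := hC
  induction L with
  | nil => rw [← emptyP_eq]; exact he
  | cons a L ih =>
    rw [List.map_cons, List.nodup_cons] at hL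
    refine tensor_disj hT ⊥ ⊥ ⊥ [a] [a] L L ?_ (ih hL.2) (fun _ _ _ _ => Iff.rfl)
      (fun _ _ _ _ => Iff.rfl) ?_
    · rcases a with ⟨c, x⟩
      rw [← idPart_eq]
      cases c <;> assumption
    · intro x hx y hy h
      have h : x.2 = y.2 := h
      have hx : x = a := by simpa using hx
      have hy : y ∈ L := by simpa using hy
      subst hx
      exact hL.1 (h ▸ List.mem_map_of_mem hy)

theorem capL_mem {C : Set TCP} (hC : IsCategory C) {α : Type} (L₁ L₂ : List (Bool × α))
    (c d : Bool) (hcd : d = !c) (x y : α)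
    (hL : ((L₁ ++ (c, x) :: (d, y) :: L₂).map Prod.snd).Nodup) :
    ofList (glue ⊥ [(x, y)]) (L₁ ++ (c, x) :: (d, y) :: L₂) (L₁ ++ L₂) ∈ C := by
  have hC' := hC
  obtain ⟨-, -, -, h1, h2, hT, hI, -⟩ := hC
  have hcap : ofList (glue ⊥ [(x, y)]) [(c, x), (d, y)] [] ∈ C := by
    rw [← invol_ofList, ← lpair_eq _ _ _ _ _ (glue_mem _ _ (by simp))]
    apply hI
    subst hcd
    cases c <;> assumption
  have hL' := hL
  simp only [List.map_append, List.map_cons, List.nodup_append, List.nodup_cons] at hL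
  have hg : ∀ a b : α, glue ⊥ [(x, y)] a b ↔ a = b ∨ ((a = x ∨ a = y) ∧ (b = x ∨ b = y)) :=
    fun a b => glue_one ⊥ x y a b
  have m2 : ∀ z ∈ L₂, z.2 ≠ x ∧ z.2 ≠ y := by
    intro z hz
    have : z.2 ∈ L₂.map Prod.snd := List.mem_map_of_mem hz
    constructor <;> rintro rfl <;> simp_all
  have m1 : ∀ z ∈ L₁, z.2 ≠ x ∧ z.2 ≠ y ∧ ∀ w ∈ L₂, z.2 ≠ w.2 := by
    intro z hz
    have h := hL.2.2 z.2 (List.mem_map_of_mem hz)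
    refine ⟨h _ (by simp), h _ (by simp), fun w hw => h _ ?_⟩
    simp only [List.mem_cons]
    exact .inr (.inr (List.mem_map_of_mem hw))
  have b1 := tensor_disj hT _ ⊥ (glue ⊥ [(x, y)]) _ _ L₂ L₂ hcap
    (idL_mem hC' L₂ hL.2.1.2.2) (fun _ _ _ _ => Iff.rfl) ?_ ?_
  · refine tensor_disj hT ⊥ _ (glue ⊥ [(x, y)]) L₁ L₁ _ _ (idL_mem hC' L₁ hL.1) b1 ?_
      (fun _ _ _ _ => Iff.rfl) ?_
    · intro z hz w hw
      rw [hg]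
      have hz : z ∈ L₁ := by simpa using hz
      have := m1 z hz
      exact ⟨fun h => .inl h, fun h => h.elim id fun h => by tauto⟩
    · intro z hz w hw
      rw [hg]
      have hz : z ∈ L₁ := by simpa using hz
      have := m1 z hz
      have h4 : w = (c, x) ∨ w = (d, y) ∨ w ∈ L₂ := by
        simp at hw; tauto
      rcases h4 with rfl | rfl | h4
      · simp; tauto
      · simp; tauto
      · have := this.2.2 w h4
        tauto
  · intro z hz w hw
    rw [hg]
    have hz : z ∈ L₂ := by simpa using hz
    have := m2 z hz
    exact ⟨fun h => .inl h, fun h => h.elim id fun h => by tauto⟩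
  · intro z hz w hw
    rw [hg]
    have hw : w ∈ L₂ := by simpa using hw
    have := m2 w hw
    have h4 : z = (c, x) ∨ z = (d, y) := by simpa using hz
    rcases h4 with rfl | rfl <;> simp <;> tauto

theorem erase_nodup {C : Set TCP} (hC : IsCategory C) {α : Type} (S : Setoid α)
    (U L₁ L₂ : List (Bool × α))
    (c d : Bool) (hcd : d = !c) (x y : α)
    (hL : ((L₁ ++ (c, x) :: (d, y) :: L₂).map Prod.snd).Nodup)
    (h : ofList S U (L₁ ++ (c, x) :: (d, y) :: L₂) ∈ C) :
    ofList (glue S [(x, y)]) U (L₁ ++ L₂) ∈ C := by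
  have hX := capL_mem hC L₁ L₂ c d hcd x y hL
  have hcomp : Composable (ofList (glue ⊥ [(x, y)]) (L₁ ++ (c, x) :: (d, y) :: L₂) (L₁ ++ L₂))
    (ofList S U (L₁ ++ (c, x) :: (d, y) :: L₂)) := ⟨rfl, fun j => rfl⟩
  have := hC.2.2.2.2.2.2.2 _ _ hcomp hX h
  rw [comp_ofList] at this
  set L := L₁ ++ (c, x) :: (d, y) :: L₂ with hLdef
  set G := glue (sumSetoid (glue ⊥ [(x, y)]) S) (List.zip (L.map (fun a => Sum.inl a.2))
        (L.map (fun a => Sum.inr a.2))) with hG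
  have hz : ∀ a b, (a, b) ∈ (List.zip (L.map (fun a => (Sum.inl a.2 : α ⊕ α)))
        (L.map (fun a => (Sum.inr a.2 : α ⊕ α)))) ↔ ∃ z ∈ L, a = .inl z.2 ∧ b = .inr z.2 := by
    intro a b
    rw [List.zip_map']
    simp only [List.mem_map, Prod.mk.injEq]
    constructor <;> rintro ⟨z, h1, h2, h3⟩ <;> exact ⟨z, h1, h2.symm, h3.symm⟩
  rw [newLabels (Sum.elim id id) G (glue S [(x, y)])] at this
  · simpa [rl, Function.comp_def, Prod.map] using this
  · have hGm : ∀ z ∈ L, G (.inl z.2) (.inr z.2) := fun z hzL =>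
      glue_mem _ _ ((hz _ _).2 ⟨z, hzL, rfl, rfl⟩)
    have fwd : G ≤ (glue S [(x, y)]).comap (Sum.elim id id) := by
      apply glue_le
      · rintro (a | a) (b | b) hab
        · have hab : glue ⊥ [(x, y)] a b := hab
          have : glue ⊥ [(x, y)] ≤ glue S [(x, y)] :=
            glue_le bot_le fun _ _ h => glue_mem _ _ h
          exact this hab
        · exact hab.elim
        · exact hab.elim
        · exact le_glue S _ hab
      · intro a b hab
        obtain ⟨z, -, rfl, rfl⟩ := (hz _ _).1 hab
        exact (glue S [(x, y)]).refl _
    have bwd : glue S [(x, y)] ≤ G.comap Sum.inr := by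
      apply glue_le
      · intro a b hab
        exact le_glue _ _ (show sumSetoid _ S (.inr a) (.inr b) from hab)
      · intro a b hab
        simp only [List.mem_singleton, Prod.mk.injEq] at hab
        obtain ⟨rfl, rfl⟩ := hab
        have h1 := hGm (c, a) (by simp [hLdef])
        have h2 := hGm (d, b) (by simp [hLdef])
        have h3 : G (.inl a) (.inl b) := le_glue _ _
          (show sumSetoid (glue ⊥ [(a, b)]) S (.inl a) (.inl b) from glue_mem _ _ (by simp))
        exact G.trans (G.symm h1) (G.trans h3 h2)
    have ret : ∀ z ∈ rl Sum.inr U ++ rl Sum.inl (L₁ ++ L₂),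
        G z.2 (.inr (Sum.elim id id z.2)) := by
      intro z hz
      simp only [rl, List.mem_append, List.mem_map] at hz
      rcases hz with ⟨w, hw, rfl⟩ | ⟨w, hw, rfl⟩
      · exact G.refl _
      · refine hGm w ?_
        rw [hLdef]
        simp; tauto
    intro a ha b hb
    refine ⟨fun h => fwd h, fun h => ?_⟩
    exact G.trans (ret a ha) (G.trans (bwd h) (G.symm (ret b hb)))

theorem exists_nodup {α : Type} (U L : List (Bool × α)) :
    ∃ (β : Type) (f : β → α) (U' L' : List (Bool × β)),
      rl f U' = U ∧ rl f L' = L ∧ (L'.map Prod.snd).Nodup := by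
  refine ⟨Fin U.length ⊕ Fin L.length,
    Sum.elim (fun j => (U.get j).2) (fun i => (L.get i).2),
    List.ofFn fun j => ((U.get j).1, Sum.inl j), List.ofFn fun j => ((L.get j).1, Sum.inr j),
    ?_, ?_, ?_⟩
  · simp only [rl, List.map_ofFn]
    exact List.ofFn_get U
  · simp only [rl, List.map_ofFn]
    exact List.ofFn_get L
  · simp only [List.map_ofFn]
    rw [List.nodup_ofFn]
    intro a b hab
    simpa using hab

theorem erase_list {C : Set TCP} (hC : IsCategory C) {α : Type} (S : Setoid α)
    (U L₁ L₂ : List (Bool × α))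
    (c d : Bool) (hcd : d = !c) (x y : α)
    (h : ofList S U (L₁ ++ (c, x) :: (d, y) :: L₂) ∈ C) :
    ofList (glue S [(x, y)]) U (L₁ ++ L₂) ∈ C := by
  obtain ⟨β, f, U', L', hU', hL', hnd⟩ := exists_nodup U (L₁ ++ (c, x) :: (d, y) :: L₂)
  obtain ⟨L₁', R, rfl, e1, e2⟩ := List.map_eq_append_iff.1 hL'
  obtain ⟨a, R, rfl, e3, e4⟩ := List.map_eq_cons_iff.1 e2
  obtain ⟨b, L₂', rfl, e5, e6⟩ := List.map_eq_cons_iff.1 e4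
  obtain ⟨c', x'⟩ := a
  obtain ⟨d', y'⟩ := b
  simp only [Prod.map, id, Prod.mk.injEq] at e3 e5
  obtain ⟨rfl, ex⟩ := e3
  obtain ⟨rfl, ey⟩ := e5
  rw [← hU', ← hL', ← newLabels f (S.comap f) S _ _ (fun _ _ _ _ => Iff.rfl)] at h
  have := erase_nodup hC _ _ _ _ _ _ hcd _ _ hnd h
  rw [newLabels f _ (glue S [(x, y)])] at this
  · simpa [hU', e1, e6] using this
  · intro z _ w _
    rw [glue_one, glue_one, ← ex, ← ey]
    exact Iff.rfl

theorem IsCategory.rots {C : Set TCP} (hC : IsCategory C) : Rots C := by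
  have hI : ∀ {α : Type} (S : Setoid α) U L, ofList S U L ∈ C → ofList S L U ∈ C := by
    intro α S U L h
    rw [← invol_ofList]
    exact hC.2.2.2.2.2.2.1 _ h
  have hid : ∀ {α : Type} (S : Setoid α) a, ofList S [a] [a] ∈ C := by
    rintro α S ⟨c, x⟩
    rw [← idPart_eq]
    cases c
    · exact hC.2.2.1
    · exact hC.2.1
  have hT := hC.2.2.2.2.2.1
  have ul : ∀ {α : Type} (S : Setoid α) a U L, ofList S U (a :: L) ∈ C →
      ofList S (fl a :: U) L ∈ C := by
    intro α S a U L h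
    have h1 := hT _ _ (hid S (fl a)) h
    rw [tensor_ofList] at h1
    have h2 := erase_list hC (sumSetoid S S) _ [] (rl .inr L) (!a.1) a.1 (by simp)
      (.inl a.2) (.inr a.2) h1
    rw [newLabels (Sum.elim id id) _ S] at h2
    · simpa [rl, Function.comp_def, Prod.map] using h2
    · have key : ∀ z ∈ (rl Sum.inl [fl a] ++ rl Sum.inr U) ++ ([] ++ rl Sum.inr L),
          z.2 = Sum.inl a.2 ∨ ∃ w, z.2 = (Sum.inr w : α ⊕ α) := by
        intro z hz
        simp only [rl, List.nil_append, List.map_cons, List.map_nil, List.mem_append,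
          List.mem_singleton, List.mem_map] at hz
        rcases hz with (rfl | ⟨w, -, rfl⟩) | ⟨w, -, rfl⟩
        · exact .inl rfl
        · exact .inr ⟨_, rfl⟩
        · exact .inr ⟨_, rfl⟩
      intro z hz w hw
      rw [glue_one]
      rcases key z hz with ez | ⟨u, ez⟩ <;> rcases key w hw with ew | ⟨v, ew⟩ <;> rw [ez, ew]
      · exact ⟨fun _ => S.refl _, fun _ => .inl ((sumSetoid S S).refl _)⟩
      · change (False ∨ (S _ _ ∨ False) ∧ (False ∨ S _ _)) ↔ S a.2 v
        have := S.refl a.2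
        have : S a.2 v → S v a.2 := S.symm
        have : S v a.2 → S a.2 v := S.symm
        tauto
      · change (False ∨ (False ∨ S _ _) ∧ (S _ _ ∨ False)) ↔ S u a.2
        have := S.refl a.2
        tauto
      · change (S u v ∨ (False ∨ S _ _) ∧ (False ∨ S _ _)) ↔ S u v
        refine ⟨?_, fun h => .inl h⟩
        rintro (h | ⟨h | h, h' | h'⟩)
        · exact h
        all_goals first | exact h.elim | exact h'.elim | exact S.trans h (S.symm h')
  have ur : ∀ {α : Type} (S : Setoid α) a U L, ofList S U (L ++ [a]) ∈ C →
      ofList S (U ++ [fl a]) L ∈ C := by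
    intro α S a U L h
    have h1 := hT _ _ h (hid S (fl a))
    rw [tensor_ofList] at h1
    have h2 := erase_list hC (sumSetoid S S) (rl .inl U ++ rl .inr [fl a])
      (rl .inl L) [] a.1 (!a.1) (by simp)
      (.inl a.2) (.inr a.2) (by simpa [rl, fl, Prod.map] using h1)
    rw [newLabels (Sum.elim id id) _ S] at h2
    · simpa [rl, Function.comp_def, Prod.map] using h2
    · have key : ∀ z ∈ (rl Sum.inl U ++ rl Sum.inr [fl a]) ++ (rl Sum.inl L ++ []),
          z.2 = Sum.inr a.2 ∨ ∃ w, z.2 = (Sum.inl w : α ⊕ α) := by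
        intro z hz
        simp only [rl, List.append_nil, List.map_cons, List.map_nil, List.mem_append,
          List.mem_singleton, List.mem_map] at hz
        rcases hz with (⟨w, -, rfl⟩ | rfl) | ⟨w, -, rfl⟩
        · exact .inr ⟨_, rfl⟩
        · exact .inl rfl
        · exact .inr ⟨_, rfl⟩
      intro z hz w hw
      rw [glue_one]
      rcases key z hz with ez | ⟨u, ez⟩ <;> rcases key w hw with ew | ⟨v, ew⟩ <;> rw [ez, ew]
      · exact ⟨fun _ => S.refl _, fun _ => .inl ((sumSetoid S S).refl _)⟩
      · change (False ∨ (False ∨ S _ _) ∧ (S _ _ ∨ False)) ↔ S a.2 v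
        have := S.refl a.2
        have : S a.2 v → S v a.2 := S.symm
        have : S v a.2 → S a.2 v := S.symm
        tauto
      · change (False ∨ (S _ _ ∨ False) ∧ (False ∨ S _ _)) ↔ S u a.2
        have := S.refl a.2
        tauto
      · change (S u v ∨ (S _ _ ∨ False) ∧ (S _ _ ∨ False)) ↔ S u v
        refine ⟨?_, fun h => .inl h⟩
        rintro (h | ⟨h | h, h' | h'⟩)
        · exact h
        all_goals first | exact h.elim | exact h'.elim | exact S.trans h (S.symm h')
  exact ⟨fun S a U L h => hI _ _ _ (ul S a L U (hI _ _ _ h)),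
    fun S a U L h => hI _ _ _ (ur S a L U (hI _ _ _ h)), ul, ur⟩


open Classical in
/-- the truth value of a proposition -/
noncomputable def tb (P : Prop) : Bool := decide P

@[simp] theorem tb_eq {P : Prop} : tb P = true ↔ P := by simp [tb]

theorem row_filter {n m : ℕ} (f : Fin m → Fin n) (hf : StrictMono f) (P : Fin n → Prop)
    (hr : ∀ j, P j ↔ ∃ i, f i = j) : List.ofFn f = (List.finRange n).filter (fun j => tb (P j)) := by
  apply List.SortedLT.eq_of_mem_iff
  · exact List.sortedLT_ofFn_iff.2 hf
  · exact ((List.sortedLT_finRange n).pairwise.filter _).sortedLT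
  · intro j
    simp [hr]

theorem nodup_filter_ne {α : Type} (A B : List (Bool × α)) (x y : Bool × α)
    (h : ((A ++ x :: y :: B).map Prod.snd).Nodup) :
    (A ++ x :: y :: B).filter (fun z => tb (z.2 ≠ x.2 ∧ z.2 ≠ y.2)) = A ++ B := by
  simp only [List.map_append, List.map_cons, List.nodup_append, List.nodup_cons] at h
  have hA : A.filter (fun z => tb (z.2 ≠ x.2 ∧ z.2 ≠ y.2)) = A := by
    rw [List.filter_eq_self]
    intro z hz
    have h := h.2.2 z.2 (List.mem_map_of_mem hz)
    exact tb_eq.2 ⟨h _ (by simp), h _ (by simp)⟩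
  have hB : B.filter (fun z => tb (z.2 ≠ x.2 ∧ z.2 ≠ y.2)) = B := by
    rw [List.filter_eq_self]
    intro z hz
    have : z.2 ∈ B.map Prod.snd := List.mem_map_of_mem hz
    refine tb_eq.2 ⟨?_, ?_⟩ <;> intro e <;> rw [e] at this <;> simp_all
  rw [List.filter_append, List.filter_cons_of_neg (by simp), List.filter_cons_of_neg (by simp),
    hA, hB]

theorem rf_filter {α : Type} (P : α → Prop) (L : List (Bool × α)) :
    (rf L).filter (fun z => tb (P z.2)) = rf (L.filter (fun z => tb (P z.2))) := by
  simp only [rf, List.filter_reverse, List.filter_map]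
  rfl

/-- the points of a partition in cyclic order, with normalized colors -/
def flatL (p : TCP) : List (Bool × p.Point) := p.loL ++ rf p.upL

theorem flatL_length (p : TCP) : p.flatL.length = p.size := by
  simp [flatL, loL, upL, rf, size, Nat.add_comm]

theorem flatL_nodup (p : TCP) : (p.flatL.map Prod.snd).Nodup := by
  have e : p.flatL.map Prod.snd =
      (List.ofFn fun j => (Sum.inr j : p.Point)) ++ (List.ofFn fun j => (Sum.inl j : p.Point)).reverse := by
    simp [flatL, loL, upL, rf, List.map_ofFn, Function.comp_def, fl]
  rw [e, List.nodup_append]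
  refine ⟨?_, ?_, ?_⟩
  · rw [List.nodup_ofFn]; exact Sum.inr_injective
  · rw [List.nodup_reverse, List.nodup_ofFn]; exact Sum.inl_injective
  · intro a ha b hb
    simp only [List.mem_ofFn, List.mem_reverse] at ha hb
    obtain ⟨i, rfl⟩ := ha
    obtain ⟨j, rfl⟩ := hb
    simp

theorem pos_lt (p : TCP) (x : p.Point) : p.pos x < p.size := by
  rcases x with j | j <;> have := j.isLt <;> simp only [pos, size] <;> omega

theorem flatL_getElem (p : TCP) (x : p.Point) (h : p.pos x < p.flatL.length) :
    p.flatL[p.pos x] = (p.ncolor x, x) := by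
  rcases x with j | j
  · have hj := j.isLt
    simp only [flatL, pos] at h ⊢
    rw [List.getElem_append_right (by simp [loL])]
    have e : p.lower + (p.upper - 1 - j) - p.loL.length = p.upper - 1 - j := by simp [loL]
    simp only [e]
    have e2 : p.upper - 1 - (p.upper - 1 - j) = j := by omega
    simp [rf, upL, fl, ncolor, e2]
  · simp only [flatL, pos]
    rw [List.getElem_append_left (by simp [loL])]
    simp [loL, ncolor]

theorem ends_split {β : Type} (F : List β) (x y : β) (hl : 2 ≤ F.length)
    (h0 : F[0]? = some x) (h1 : F[F.length - 1]? = some y) : ∃ w, F = x :: (w ++ [y]) := by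
  rcases F with _ | ⟨z, F⟩
  · simp at hl
  · rcases List.eq_nil_or_concat F with rfl | ⟨F, t, rfl⟩
    · simp at hl
    · rw [List.concat_eq_append] at *
      refine ⟨F, ?_⟩
      simp at h0 h1
      rw [h0, h1]

theorem erase_of_list {C : Set TCP} (hC : Rots C)
    (hE : ∀ {α : Type} (S : Setoid α) (L₁ L₂ : List (Bool × α)) (c d : Bool), d = (!c) →
      ∀ x y : α, ofList S [] (L₁ ++ (c, x) :: (d, y) :: L₂) ∈ C →
        ofList (glue S [(x, y)]) [] (L₁ ++ L₂) ∈ C)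
    (p q : TCP) (a b : p.Point) (hp : p ∈ C) (h : IsErasing p a b q) : q ∈ C := by
  obtain ⟨⟨hrel, hcol⟩, e, -, hrange, hup, hlo, hou, hol, hc, hr⟩ := h
  have hmem : ∀ x, (x ≠ a ∧ x ≠ b) ↔ ∃ y, e y = x := by
    intro x
    have : x ∈ Set.range e ↔ x ∈ {x | x ≠ a ∧ x ≠ b} := by rw [hrange]
    exact this.symm
  have hU : rl e q.upL = p.upL.filter (fun z => tb (z.2 ≠ a ∧ z.2 ≠ b)) := by
    choose f hf using hup
    have hm : StrictMono f := fun j₁ j₂ hj => (hou j₁ j₂ _ _ (hf _) (hf _)).1 hj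
    have h1 := row_filter f hm (fun j => (Sum.inl j : p.Point) ≠ a ∧ (Sum.inl j : p.Point) ≠ b) (by
      intro j
      rw [hmem]
      constructor
      · rintro ⟨y | y, hy⟩
        · exact ⟨y, Sum.inl_injective ((hf y).symm.trans hy)⟩
        · obtain ⟨i, hi⟩ := hlo y
          rw [hi] at hy
          exact absurd hy (by simp)
      · rintro ⟨i, rfl⟩
        exact ⟨_, hf i⟩)
    have h2 : rl e q.upL = (List.ofFn f).map (fun j => (p.upColor j, (Sum.inl j : p.Point))) := by
      simp only [upL, rl, List.map_ofFn]
      congr 1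
      funext j
      have := hc (.inl j)
      rw [hf] at this
      simp only [Function.comp, Prod.map, id, hf]
      exact Prod.ext this rfl
    rw [h2, h1, upL, List.ofFn_eq_map, List.filter_map]
    rfl
  have hL : rl e q.loL = p.loL.filter (fun z => tb (z.2 ≠ a ∧ z.2 ≠ b)) := by
    choose f hf using hlo
    have hm : StrictMono f := fun j₁ j₂ hj => (hol j₁ j₂ _ _ (hf _) (hf _)).1 hj
    have h1 := row_filter f hm (fun j => (Sum.inr j : p.Point) ≠ a ∧ (Sum.inr j : p.Point) ≠ b) (by
      intro j
      rw [hmem]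
      constructor
      · rintro ⟨y | y, hy⟩
        · obtain ⟨i, hi⟩ := hup y
          rw [hi] at hy
          exact absurd hy (by simp)
        · exact ⟨y, Sum.inr_injective ((hf y).symm.trans hy)⟩
      · rintro ⟨i, rfl⟩
        exact ⟨_, hf i⟩)
    have h2 : rl e q.loL = (List.ofFn f).map (fun j => (p.loColor j, (Sum.inr j : p.Point))) := by
      simp only [loL, rl, List.map_ofFn]
      congr 1
      funext j
      have := hc (.inr j)
      rw [hf] at this
      simp only [Function.comp, Prod.map, id, hf]
      exact Prod.ext this rfl
    rw [h2, h1, loL, List.ofFn_eq_map, List.filter_map]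
    rfl
  rw [eq_toList q, newLabels e _ (glue p.rel [(a, b)]) _ _ (by
    intro x _ y _
    rw [glue_one]
    exact hr _ _), hU, hL, hC.flat, ← rf_filter (fun z => z ≠ a ∧ z ≠ b), ← List.filter_append]
  rw [eq_toList p, hC.flat] at hp
  change ofList p.rel [] p.flatL ∈ C at hp
  change ofList _ [] (p.flatL.filter _) ∈ C
  have hnd := p.flatL_nodup
  have hlen := p.flatL_length
  have hpa := p.pos_lt a
  have hpb := p.pos_lt b
  have ga := p.flatL_getElem a (by omega)
  have gb := p.flatL_getElem b (by omega)
  have hcol' : p.ncolor b = !p.ncolor a := by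
    revert hcol; cases p.ncolor a <;> cases p.ncolor b <;> simp
  unfold relpos at hrel
  by_cases hlt : p.pos a < p.pos b
  · have hb : p.pos b = p.pos a + 1 := by
      have : p.size + p.pos b - p.pos a = p.size + (p.pos b - p.pos a) := by omega
      rw [this, Nat.add_mod_left, Nat.mod_eq_of_lt (by omega)] at hrel
      omega
    have hsplit : p.flatL = p.flatL.take (p.pos a) ++ (p.ncolor a, a) :: (p.ncolor b, b) ::
        p.flatL.drop (p.pos b + 1) := by
      rw [← ga, ← gb, ← List.drop_eq_getElem_cons]
      simp only [hb]
      rw [← List.drop_eq_getElem_cons, List.take_append_drop]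
    rw [hsplit] at hp hnd ⊢
    have h3 := hE _ _ _ _ _ hcol' _ _ hp
    have h4 := nodup_filter_ne _ _ _ _ hnd
    simp only at h4
    rw [h4]
    exact h3
  · have hne : p.pos a ≠ p.pos b := by
      intro h
      rw [h, Nat.add_sub_cancel, Nat.mod_self] at hrel
      omega
    rw [Nat.mod_eq_of_lt (by omega)] at hrel
    have hb : p.pos b = 0 := by omega
    have ha : p.pos a = p.size - 1 := by omega
    obtain ⟨w, hw⟩ : ∃ w, p.flatL = (p.ncolor b, b) :: (w ++ [(p.ncolor a, a)]) := by
      refine ends_split _ _ _ (by omega) ?_ ?_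
      · rw [← gb]; simp only [hb]; exact List.getElem?_eq_getElem _
      · rw [← ga]
        have : p.flatL.length - 1 = p.pos a := by omega
        rw [this]
        exact List.getElem?_eq_getElem _
    rw [hw] at hp hnd ⊢
    have hp' := hC.cyc _ [(p.ncolor b, b)] (w ++ [(p.ncolor a, a)]) hp
    rw [List.append_assoc] at hp'
    have h3 := hE _ w [] _ _ hcol' _ _ hp'
    have hperm : ((p.ncolor b, b) :: (w ++ [(p.ncolor a, a)])).Perm
        (w ++ (p.ncolor a, a) :: (p.ncolor b, b) :: []) := by
      have := (List.perm_append_comm (l₁ := [(p.ncolor b, b)]) (l₂ := w ++ [(p.ncolor a, a)]))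
      simpa using this
    have hnd' := ((hperm.map Prod.snd).nodup_iff).1 hnd
    have h4 := nodup_filter_ne _ _ _ _ hnd'
    simp only at h4
    rw [List.filter_append, List.filter_cons_of_neg (by simp), List.filter_cons_of_neg (by simp)]
      at h4
    rw [List.filter_cons_of_neg (by simp), List.filter_append, List.filter_cons_of_neg (by simp),
      h4]
    exact h3

/-! ### From the alternative description to categories -/

theorem isErasing_list {α : Type} (S : Setoid α) (L₁ L₂ : List (Bool × α)) (c d : Bool)
    (hcd : d = !c) (x y : α) :
    IsErasing (ofList S [] (L₁ ++ (c, x) :: (d, y) :: L₂))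
      (.inr ⟨L₁.length, by simp [ofList]⟩) (.inr ⟨L₁.length + 1, by simp [ofList]⟩)
      (ofList (glue S [(x, y)]) [] (L₁ ++ L₂)) := by
  have hlen : (ofList S [] (L₁ ++ (c, x) :: (d, y) :: L₂)).lower = L₁.length + L₂.length + 2 := by
    simp [ofList]; omega
  have hlen' : (ofList (glue S [(x, y)]) [] (L₁ ++ L₂)).lower = L₁.length + L₂.length := by
    simp [ofList]
  refine ⟨⟨?_, ?_⟩, ?_⟩
  · simp only [relpos, pos, size, hlen]
    have : (ofList S [] (L₁ ++ (c, x) :: (d, y) :: L₂)).upper = 0 := rfl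
    rw [this]
    have : 0 + (L₁.length + L₂.length + 2) + (L₁.length + 1) - L₁.length =
      1 + (0 + (L₁.length + L₂.length + 2)) := by omega
    rw [this, Nat.add_mod_right, Nat.mod_eq_of_lt (by omega)]
  · subst hcd
    simp [ncolor, ofList]
  · let s : ℕ → ℕ := fun i => if i < L₁.length then i else i + 2
    have hs : ∀ i, i < L₁.length + L₂.length → s i < L₁.length + L₂.length + 2 := by
      intro i hi; simp only [s]; split_ifs <;> omega
    let e : (ofList (glue S [(x, y)]) [] (L₁ ++ L₂)).Point →
        (ofList S [] (L₁ ++ (c, x) :: (d, y) :: L₂)).Point :=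
      Sum.elim (fun j => j.elim0)
        (fun i => .inr ⟨s i, by rw [hlen]; exact hs i (by have := i.isLt; omega)⟩)
    have hget : ∀ i (hi : i < (L₁ ++ L₂).length)
        (hi' : s i < (L₁ ++ (c, x) :: (d, y) :: L₂).length),
        (L₁ ++ L₂)[i] = (L₁ ++ (c, x) :: (d, y) :: L₂)[s i] := by
      intro i hi hi'
      by_cases h : i < L₁.length
      · have : s i = i := if_pos h
        simp only [this]
        rw [List.getElem_append_left h, List.getElem_append_left h]
      · have : s i = i + 2 := if_neg h
        simp only [this]
        rw [List.getElem_append_right (by omega), List.getElem_append_right (by omega)]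
        have : i + 2 - L₁.length = (i - L₁.length) + 1 + 1 := by omega
        simp only [this, List.getElem_cons_succ]
    refine ⟨e, ?_, ?_, ?_, ?_, ?_, ?_, ?_, ?_⟩
    · rintro (i | i) (j | j) hij
      · exact i.elim0
      · exact i.elim0
      · exact j.elim0
      · have : s i = s j := by simpa [e] using hij
        have : i.val = j.val := by
          simp only [s] at this
          split_ifs at this <;> omega
        rw [Fin.ext this]
    · ext z
      rcases z with z | z
      · exact z.elim0
      · have hz : z.val < L₁.length + L₂.length + 2 := lt_of_lt_of_eq z.isLt hlen
        constructor
        · rintro ⟨i | i, hi⟩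
          · exact i.elim0
          · have : s i = z := by
              have := Sum.inr_injective hi
              exact congrArg Fin.val this
            simp only [Set.mem_ofPred_eq, ne_eq, Sum.inr.injEq, Fin.ext_iff]
            simp only [s] at this
            split_ifs at this <;> omega
        · rintro ⟨h1, h2⟩
          simp only [ne_eq, Sum.inr.injEq, Fin.ext_iff] at h1 h2
          by_cases h : z.val < L₁.length
          · refine ⟨.inr ⟨z, by rw [hlen']; omega⟩, ?_⟩
            simp [e, s, h]
          · refine ⟨.inr ⟨z.val - 2, by rw [hlen']; omega⟩, ?_⟩
            have h' : ¬ (z.val - 2 < L₁.length) := by omega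
            have h'' : z.val - 2 + 2 = z.val := by omega
            simp [e, s, h', h'']
    · intro j; exact j.elim0
    · intro i; exact ⟨_, rfl⟩
    · intro j; exact j.elim0
    · intro i j i' j' hi hj
      have h1 : s i = i' := congrArg Fin.val (Sum.inr_injective hi)
      have h2 : s j = j' := congrArg Fin.val (Sum.inr_injective hj)
      rw [Fin.lt_def, Fin.lt_def, ← h1, ← h2]
      simp only [s]
      split_ifs <;> omega
    · rintro (i | i)
      · exact i.elim0
      · exact congrArg Prod.fst (hget i i.isLt _)
    · rintro (i | i) (j | j)
      · exact i.elim0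
      · exact i.elim0
      · exact j.elim0
      · have hl : (L₁ ++ (c, x) :: (d, y) :: L₂).length = L₁.length + L₂.length + 2 := hlen
        have hi : s i < (L₁ ++ (c, x) :: (d, y) :: L₂).length :=
          lt_of_lt_of_eq (hs i (lt_of_lt_of_eq i.isLt hlen')) hlen.symm
        have hj : s j < (L₁ ++ (c, x) :: (d, y) :: L₂).length :=
          lt_of_lt_of_eq (hs j (lt_of_lt_of_eq j.isLt hlen')) hlen.symm
        have e1 := congrArg Prod.snd (hget i i.isLt hi)
        have e2 := congrArg Prod.snd (hget j j.isLt hj)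
        have ex : ((L₁ ++ (c, x) :: (d, y) :: L₂)[L₁.length]'(by omega)).2 = x := by simp
        have ey : ((L₁ ++ (c, x) :: (d, y) :: L₂)[L₁.length + 1]'(by omega)).2 = y := by simp
        change glue S [(x, y)] ((L₁ ++ L₂)[i.val]'i.isLt).2 ((L₁ ++ L₂)[j.val]'j.isLt).2 ↔
          S ((L₁ ++ (c, x) :: (d, y) :: L₂)[s i]).2 ((L₁ ++ (c, x) :: (d, y) :: L₂)[s j]).2 ∨
          ((S ((L₁ ++ (c, x) :: (d, y) :: L₂)[s i]).2
              ((L₁ ++ (c, x) :: (d, y) :: L₂)[L₁.length]'(by omega)).2 ∨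
            S ((L₁ ++ (c, x) :: (d, y) :: L₂)[s i]).2
              ((L₁ ++ (c, x) :: (d, y) :: L₂)[L₁.length + 1]'(by omega)).2) ∧
          (S ((L₁ ++ (c, x) :: (d, y) :: L₂)[s j]).2
              ((L₁ ++ (c, x) :: (d, y) :: L₂)[L₁.length]'(by omega)).2 ∨
            S ((L₁ ++ (c, x) :: (d, y) :: L₂)[s j]).2
              ((L₁ ++ (c, x) :: (d, y) :: L₂)[L₁.length + 1]'(by omega)).2))
        rw [glue_one, ex, ey, e1, e2]

theorem rl_rf {α β : Type} (f : α → β) (L : List (Bool × α)) : rl f (rf L) = rf (rl f L) := by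
  simp only [rl, rf, List.map_reverse, List.map_map]
  rfl

theorem comp_flat {C : Set TCP}
    (hE : ∀ {α : Type} (S : Setoid α) (L₁ L₂ : List (Bool × α)) (c d : Bool), d = (!c) →
      ∀ x y : α, ofList S [] (L₁ ++ (c, x) :: (d, y) :: L₂) ∈ C →
        ofList (glue S [(x, y)]) [] (L₁ ++ L₂) ∈ C)
    {α : Type} (A B : List (Bool × α)) :
    ∀ (M M' : List (Bool × α)) (S : Setoid α), M.map Prod.fst = M'.map Prod.fst →
      ofList S [] (A ++ rf M ++ (M' ++ B)) ∈ C →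
      ofList (glue S (List.zip (M.map Prod.snd) (M'.map Prod.snd))) [] (A ++ B) ∈ C
  | [], [], S, _, h => by simpa [glue_nil] using h
  | [], _ :: _, S, h, _ => by simp at h
  | _ :: _, [], S, h, _ => by simp at h
  | (c, x) :: M, (c', y) :: M', S, hc, h => by
    simp only [List.map_cons, List.cons.injEq] at hc
    obtain ⟨hc1, hc2⟩ := hc
    simp only [List.map_cons, List.zip_cons_cons]
    rw [glue_cons]
    refine comp_flat hE A B M M' _ hc2 ?_
    refine hE S (A ++ rf M) (M' ++ B) (!c) c' (by simp [hc1]) x y ?_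
    have e : A ++ rf ((c, x) :: M) ++ ((c', y) :: M' ++ B) =
      A ++ rf M ++ (!c, x) :: (c', y) :: (M' ++ B) := by
      rw [rf_cons]; simp [fl]
    rwa [e] at h

theorem comp_list {C : Set TCP} (hR : Rots C)
    (hT : ∀ p q : TCP, p ∈ C → q ∈ C → p.tensor q ∈ C)
    (hE : ∀ {α : Type} (S : Setoid α) (L₁ L₂ : List (Bool × α)) (c d : Bool), d = (!c) →
      ∀ x y : α, ofList S [] (L₁ ++ (c, x) :: (d, y) :: L₂) ∈ C →
        ofList (glue S [(x, y)]) [] (L₁ ++ L₂) ∈ C)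
    {α β : Type} (S : Setoid α) (T : Setoid β) (M L : List (Bool × α)) (W M' : List (Bool × β))
    (h : Composable (ofList S M L) (ofList T W M')) (hp : ofList S M L ∈ C)
    (hq : ofList T W M' ∈ C) : comp (ofList S M L) (ofList T W M') h ∈ C := by
  have hcol : M.map Prod.fst = M'.map Prod.fst := by
    apply List.ext_getElem
    · have : M.length = M'.length := h.len
      simpa using this
    · intro i h1 h2
      have := h.col ⟨i, lt_of_lt_of_eq h1 (List.length_map _)⟩
      rw [List.getElem_map, List.getElem_map]
      exact this
  rw [comp_ofList, hR.flat]
  rw [hR.flat] at hp hq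
  have ht := hT _ _ hp hq
  rw [tensor_ofList] at ht
  have := comp_flat hE (rl .inl L) (rl .inr (rf W)) (rl .inl M) (rl .inr M') (sumSetoid S T)
    (by simpa [rl, Function.comp_def] using hcol) (by
      have e1 : rl (Sum.inl : α → α ⊕ β) (L ++ rf M) = rl .inl L ++ rf (rl .inl M) := by
        rw [← rl_rf]; simp [rl]
      have e2 : rl (Sum.inr : β → α ⊕ β) (M' ++ rf W) = rl .inr M' ++ rl .inr (rf W) := by
        simp [rl]
      rw [e1, e2] at ht
      exact ht)
  rw [rl_rf] at this
  simpa [rl, Function.comp_def] using this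

theorem category_of {C : Set TCP} (hid : idPart true ∈ C)
    (hT : ∀ p q : TCP, p ∈ C → q ∈ C → p.tensor q ∈ C)
    (hdl : ∀ p ∈ C, p.rotDownL ∈ C) (hdr : ∀ p ∈ C, p.rotDownR ∈ C)
    (hul : ∀ p ∈ C, p.rotUpL ∈ C) (hur : ∀ p ∈ C, p.rotUpR ∈ C)
    (hv : ∀ p ∈ C, p.vreflect ∈ C)
    (he : ∀ (p q : TCP) (a b : p.Point), p ∈ C → IsErasing p a b q → q ∈ C) : IsCategory C := by
  have hR : Rots C :=
    { dl := fun S a U L h => by have := hdl _ h; rwa [rotDownL_ofList] at this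
      dr := fun S a U L h => by have := hdr _ h; rwa [rotDownR_ofList] at this
      ul := fun S a U L h => by have := hul _ h; rwa [rotUpL_ofList] at this
      ur := fun S a U L h => by have := hur _ h; rwa [rotUpR_ofList] at this }
  have hE : ∀ {α : Type} (S : Setoid α) (L₁ L₂ : List (Bool × α)) (c d : Bool), d = (!c) →
      ∀ x y : α, ofList S [] (L₁ ++ (c, x) :: (d, y) :: L₂) ∈ C →
        ofList (glue S [(x, y)]) [] (L₁ ++ L₂) ∈ C :=
    fun S L₁ L₂ c d hcd x y hm => he _ _ _ _ hm (isErasing_list S L₁ L₂ c d hcd x y)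
  have hid' := hid
  rw [idPart_eq (⊤ : Setoid Unit) true ()] at hid'
  have h1 : ofList (⊤ : Setoid Unit) [] [(false, ()), (true, ())] ∈ C :=
    hR.dl _ (true, ()) [] _ hid'
  have h2 : ofList (⊤ : Setoid Unit) [] [(true, ()), (false, ())] ∈ C :=
    hR.dr _ (true, ()) [] _ hid'
  refine ⟨?_, hid, ?_, ?_, ?_, hT, ?_, ?_⟩
  · rw [emptyP_eq (glue (⊤ : Setoid Unit) [((), ())])]
    exact hE _ [] [] _ _ rfl _ _ h1
  · rw [idPart_eq (⊤ : Setoid Unit) false ()]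
    have := hv _ hid'
    rw [vreflect_ofList] at this
    exact this
  · rw [lpair_eq (⊤ : Setoid Unit) true false () () trivial]
    exact h2
  · rw [lpair_eq (⊤ : Setoid Unit) false true () () trivial]
    exact h1
  · intro p hp
    have h := hv _ hp
    rw [eq_toList p] at h ⊢
    rw [vreflect_ofList, hR.refl_invol] at h
    rwa [invol_ofList]
  · intro p q h hp hq
    have key : ∀ p' q' : TCP, p = p' → q = q' →
        (∀ h : Composable p' q', p' ∈ C → q' ∈ C → comp p' q' h ∈ C) → comp p q h ∈ C := by
      rintro _ _ rfl rfl h'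
      exact h' h hp hq
    exact key _ _ (eq_toList p) (eq_toList q) (fun h => comp_list hR hT hE _ _ _ _ _ _ h)

end TCP

/-- alternative characterization of categories of two-colored partitions. -/
theorem stmt3 (C : Set TCP) :
    TCP.IsCategory C ↔
      (TCP.idPart true ∈ C ∧
       (∀ p q : TCP, p ∈ C → q ∈ C → p.tensor q ∈ C) ∧
       (∀ p ∈ C, p.rotDownL ∈ C) ∧ (∀ p ∈ C, p.rotDownR ∈ C) ∧
       (∀ p ∈ C, p.rotUpL ∈ C) ∧ (∀ p ∈ C, p.rotUpR ∈ C) ∧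
       (∀ p ∈ C, p.vreflect ∈ C) ∧
       (∀ (p q : TCP) (a b : p.Point), p ∈ C → TCP.IsErasing p a b q → q ∈ C)) := by
  constructor
  · intro hC
    have hR := hC.rots
    refine ⟨hC.2.1, hC.2.2.2.2.2.1, fun p hp => (hR.rot p hp).1, fun p hp => (hR.rot p hp).2.1,
      fun p hp => (hR.rot p hp).2.2.1, fun p hp => (hR.rot p hp).2.2.2, ?_, ?_⟩
    · intro p hp
      have h := hC.2.2.2.2.2.2.1 _ hp
      rw [TCP.eq_toList p] at h ⊢
      rw [TCP.invol_ofList] at h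
      rwa [TCP.vreflect_ofList, hR.refl_invol]
    · intro p q a b hp h
      exact TCP.erase_of_list hR
        (fun S L₁ L₂ c d h x y hm => TCP.erase_list hC S [] L₁ L₂ c d h x y hm) p q a b hp h
  · rintro ⟨h1, h2, h3, h4, h5, h6, h7, h8⟩
    exact TCP.category_of h1 h2 h3 h4 h5 h6 h7 h8
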